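/- arXiv:1808.00614 — 3 statements merged into one kernel-verified Lean document; each statement's English description precedes it below -/
import Mathlib

section
/- Let H be a complex Hilbert space and D a densely defined self-adjoint operator on H. Suppose x and y are bounded operators on H such that: (i) x maps dom D into dom D, (ii) for every h ∈ dom D, y h = i·(D(x h) − x(D h)) (so x is weakly D-differentiable with δ^D_w(x) = y), (iii) y maps dom D into dom D, and (iv) for every h ∈ dom D, D(y h) = y(D h) (so (δ^D_w)²(x) = 0). Then y = 0. In other words, ker (δ^D_w)² = ker δ^D_w. -/
open scoped InnerProductSpace

namespace LinearPMap

variable {H : Type*} [NormedAddCommGroup H] [InnerProductSpace ℂ H]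

/-- The operator `D + c` on the domain of `D`. -/
def addScalar (D : H →ₗ.[ℂ] H) (c : ℂ) : D.domain →ₗ[ℂ] H :=
  D.toFun + c • D.domain.subtype

theorem addScalar_apply (D : H →ₗ.[ℂ] H) (c : ℂ) (h : D.domain) :
    D.addScalar c h = D h + c • (h : H) := rfl

theorem IsFormalAdjoint.norm_addScalar_I_sq {D : H →ₗ.[ℂ] H} (hD : D.IsFormalAdjoint D)
    (h : D.domain) : ‖D.addScalar Complex.I h‖ ^ 2 = ‖D h‖ ^ 2 + ‖(h : H)‖ ^ 2 := by
  have him : (⟪D h, (h : H)⟫_ℂ).im = 0 := by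
    rw [← Complex.conj_eq_iff_im, inner_conj_symm]
    exact (hD h h).symm
  rw [addScalar_apply, norm_add_sq (𝕜 := ℂ)]
  simp [inner_smul_right, norm_smul, him]

theorem IsFormalAdjoint.norm_addScalar_neg_I_sq {D : H →ₗ.[ℂ] H} (hD : D.IsFormalAdjoint D)
    (h : D.domain) : ‖D.addScalar (-Complex.I) h‖ ^ 2 = ‖D h‖ ^ 2 + ‖(h : H)‖ ^ 2 := by
  have him : (⟪D h, (h : H)⟫_ℂ).im = 0 := by
    rw [← Complex.conj_eq_iff_im, inner_conj_symm]
    exact (hD h h).symm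
  rw [addScalar_apply, norm_add_sq (𝕜 := ℂ)]
  simp [inner_smul_right, norm_smul, him]

theorem IsFormalAdjoint.injective_addScalar_I {D : H →ₗ.[ℂ] H} (hD : D.IsFormalAdjoint D) :
    Function.Injective (D.addScalar Complex.I) := by
  refine (injective_iff_map_eq_zero _).2 fun h hh => ?_
  have := hD.norm_addScalar_I_sq h
  rw [hh, norm_zero] at this
  have h0 : ‖(h : H)‖ = 0 := by nlinarith [sq_nonneg ‖D h‖, sq_nonneg ‖(h : H)‖]
  exact Subtype.ext (norm_eq_zero.1 h0)

theorem IsFormalAdjoint.injective_addScalar_neg_I {D : H →ₗ.[ℂ] H} (hD : D.IsFormalAdjoint D) :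
    Function.Injective (D.addScalar (-Complex.I)) := by
  refine (injective_iff_map_eq_zero _).2 fun h hh => ?_
  have := hD.norm_addScalar_neg_I_sq h
  rw [hh, norm_zero] at this
  have h0 : ‖(h : H)‖ = 0 := by nlinarith [sq_nonneg ‖D h‖, sq_nonneg ‖(h : H)‖]
  exact Subtype.ext (norm_eq_zero.1 h0)

variable [CompleteSpace H]

theorem IsFormalAdjoint.isClosed_range_addScalar_I {D : H →ₗ.[ℂ] H} (hD : D.IsFormalAdjoint D)
    (hc : D.IsClosed) : _root_.IsClosed (LinearMap.range (D.addScalar Complex.I) : Set H) := by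
  have hcomplete : CompleteSpace D.graph :=
    (show _root_.IsClosed (D.graph : Set (H × H)) from hc).completeSpace_coe
  let f : D.graph →L[ℂ] H :=
    (ContinuousLinearMap.snd ℂ H H + Complex.I • ContinuousLinearMap.fst ℂ H H).comp
      D.graph.subtypeL
  have hf : ∀ p : D.graph, ∃ h : D.domain, p.1 = ((h : H), D h) ∧ f p = D.addScalar Complex.I h := by
    rintro ⟨⟨a, b⟩, hp⟩
    obtain ⟨h, rfl, rfl⟩ := (mem_graph_iff D).1 hp
    exact ⟨h, rfl, rfl⟩
  have hanti : AntilipschitzWith 1 f := by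
    refine AddMonoidHomClass.antilipschitz_of_bound f fun p => ?_
    obtain ⟨h, hp, hfp⟩ := hf p
    have hn := hD.norm_addScalar_I_sq h
    rw [hfp, NNReal.coe_one, one_mul, Submodule.coe_norm, hp, Prod.norm_def]
    refine max_le ?_ ?_ <;> refine le_of_sq_le_sq ?_ (norm_nonneg _) <;> rw [hn] <;>
      simp
  have hrange : (LinearMap.range (D.addScalar Complex.I) : Set H) = Set.range f := by
    ext w
    constructor
    · rintro ⟨h, rfl⟩
      exact ⟨⟨((h : H), D h), D.mem_graph h⟩, rfl⟩
    · rintro ⟨p, rfl⟩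
      obtain ⟨h, -, hfp⟩ := hf p
      exact ⟨h, hfp.symm⟩
  rw [hrange]
  exact hanti.isClosed_range f.uniformContinuous

theorem bijective_addScalar_I {D : H →ₗ.[ℂ] H} (hdense : Dense (D.domain : Set H))
    (hsa : D.adjoint = D) : Function.Bijective (D.addScalar Complex.I) := by
  have hD : D.IsFormalAdjoint D := by
    have := adjoint_isFormalAdjoint hdense
    rwa [hsa] at this
  refine ⟨hD.injective_addScalar_I, LinearMap.range_eq_top.1 ?_⟩
  have hcl : D.IsClosed := by
    have := adjoint_isClosed hdense
    rwa [hsa] at this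
  have := (hD.isClosed_range_addScalar_I hcl).completeSpace_coe
  rw [← Submodule.orthogonal_eq_bot_iff, Submodule.eq_bot_iff]
  intro v hv
  have key : ∀ h : D.domain, ⟪Complex.I • v, (h : H)⟫_ℂ = ⟪v, D h⟫_ℂ := by
    intro h
    have h0 := (Submodule.mem_orthogonal' _ _).1 hv _ ⟨h, rfl⟩
    rw [addScalar_apply, inner_add_right, inner_smul_right] at h0
    rw [inner_smul_left, Complex.conj_I]
    linear_combination -h0
  have hv' : v ∈ D.adjoint.domain := mem_adjoint_domain_of_exists v ⟨_, key⟩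
  have happly : D.adjoint ⟨v, hv'⟩ = Complex.I • v := adjoint_apply_eq hdense ⟨v, hv'⟩ key
  rw [hsa] at hv'
  have happly' : D ⟨v, hv'⟩ = Complex.I • v := by
    rw [← happly]
    exact Eq.symm (by apply (ext_iff.1 hsa).2)
  have : (⟨v, hv'⟩ : D.domain) = 0 := hD.injective_addScalar_neg_I <| by
    rw [addScalar_apply, happly', LinearMap.map_zero]
    simp
  exact congrArg Subtype.val this

end LinearPMap

theorem mul_pow_succ_of_mul_eq_add {R : Type*} [Ring R] {a u c : R} (h : a * u = u * a + c)
    (hc : Commute c u) (n : ℕ) : a * u ^ (n + 1) = u ^ (n + 1) * a + (n + 1 : ℕ) • (u ^ n * c) := by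
  induction n with
  | zero => simp [h]
  | succ n ih =>
    rw [pow_succ u (n + 1), ← mul_assoc, ih, add_mul, mul_assoc, h, mul_add, smul_mul_assoc,
      mul_assoc, hc.eq, ← mul_assoc, ← mul_assoc, ← pow_succ, ← pow_succ, succ_nsmul _ (n + 1)]
    abel

/-- If the commutator of a bounded operator with a linear isometry `u` commutes with `u`,
then it vanishes. -/
theorem eq_zero_of_commutator_commute_isometry {H : Type*} [NormedAddCommGroup H]
    [NormedSpace ℂ H] (x : H →L[ℂ] H) (u c : Module.End ℂ H) (hu : ∀ w, ‖u w‖ = ‖w‖)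
    (h : (x : Module.End ℂ H) * u = u * x + c) (hc : Commute c u) : c = 0 := by
  have hpow : ∀ (n : ℕ) w, ‖(u ^ n) w‖ = ‖w‖ := by
    intro n
    induction n with
    | zero => simp
    | succ n ih => intro w; rw [pow_succ, Module.End.mul_apply, ih, hu]
  ext w
  by_contra hw
  have hpos : 0 < ‖c w‖ := norm_pos_iff.2 hw
  obtain ⟨n, hn⟩ := exists_nat_gt (2 * ‖x‖ * ‖w‖ / ‖c w‖)
  rw [div_lt_iff₀ hpos] at hn
  have e : x ((u ^ (n + 1)) w) = (u ^ (n + 1)) (x w) + (n + 1 : ℕ) • (u ^ n) (c w) :=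
    LinearMap.congr_fun (mul_pow_succ_of_mul_eq_add h hc n) w
  have e' : ‖(n + 1 : ℕ) • (u ^ n) (c w)‖ = (n + 1) * ‖c w‖ := by
    rw [← Nat.cast_smul_eq_nsmul ℂ, norm_smul, hpow, Complex.norm_natCast]
    push_cast
    rfl
  have h1 : ‖x ((u ^ (n + 1)) w)‖ ≤ ‖x‖ * ‖w‖ := by
    simpa only [hpow] using x.le_opNorm ((u ^ (n + 1)) w)
  have h2 : ‖(u ^ (n + 1)) (x w)‖ ≤ ‖x‖ * ‖w‖ := by
    simpa only [hpow] using x.le_opNorm w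
  have h3 := norm_sub_le (x ((u ^ (n + 1)) w)) ((u ^ (n + 1)) (x w))
  rw [e, add_sub_cancel_left, e', ← e] at h3
  nlinarith


/-- **Kernel stabilization, order 2.** If `D` is a densely defined self-adjoint operator on a
complex Hilbert space `H`, `x` is weakly `D`-differentiable with `δ^D_w(x) = y`
(i.e. `x` preserves `dom D` and `y h = i • (D (x h) - x (D h))` on `dom D`), and
`(δ^D_w)^2 x = 0` (i.e. `y` preserves `dom D` and commutes with `D` on `dom D`),
then `y = 0`.  In other words, `ker (δ^D_w)² = ker δ^D_w`. -/
theorem kernel_stabilization_two {H : Type*} [NormedAddCommGroup H] [InnerProductSpace ℂ H]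
    [CompleteSpace H] (D : H →ₗ.[ℂ] H) (hdense : Dense (D.domain : Set H))
    (hsa : D.adjoint = D) (x y : H →L[ℂ] H)
    (hx : ∀ h : D.domain, x h ∈ D.domain)
    (hxy : ∀ h : D.domain, y (h : H) = Complex.I • (D ⟨x h, hx h⟩ - x (D h)))
    (hy : ∀ h : D.domain, y h ∈ D.domain)
    (hyD : ∀ h : D.domain, D ⟨y h, hy h⟩ = y (D h)) :
    y = 0 := by
  have hD : D.IsFormalAdjoint D := by
    have := LinearPMap.adjoint_isFormalAdjoint hdense
    rwa [hsa] at this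
  let e := LinearEquiv.ofBijective _ (LinearPMap.bijective_addScalar_I hdense hsa)
  have he : ∀ h : D.domain, e h = D h + Complex.I • (h : H) := fun _ => rfl
  let r : Module.End ℂ H := D.domain.subtype ∘ₗ e.symm.toLinearMap
  have hr : ∀ w, r w = (e.symm w : H) := fun _ => rfl
  have hre : ∀ h : D.domain, r (e h) = h := fun h => by rw [hr, e.symm_apply_apply]
  have hyr : ∀ w, y (r w) = r (y w) := by
    intro w
    obtain ⟨h, rfl⟩ := e.surjective w
    have : e ⟨y h, hy h⟩ = y (e h) := by rw [he, he, hyD, map_add, map_smul]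
    rw [← this, hre, hre]
  have hxr : ∀ w, x (r w) = r (x w) - Complex.I • r (r (y w)) := by
    intro w
    obtain ⟨h, rfl⟩ := e.surjective w
    have : e ⟨x h, hx h⟩ = x (e h) - Complex.I • y h := by
      rw [he, he, hxy, map_add, map_smul, smul_smul, Complex.I_mul_I]
      module
    have h2 := congrArg r this
    rw [hre, map_sub, map_smul] at h2
    rw [← hyr, hre]
    exact h2
  let u : Module.End ℂ H := 1 - (2 * Complex.I) • r
  let c : Module.End ℂ H := (-2 : ℂ) • (r * r * (y : Module.End ℂ H))
  have hu : ∀ w, ‖u w‖ = ‖w‖ := by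
    intro w
    obtain ⟨h, rfl⟩ := e.surjective w
    have h1 : u (e h) = D.addScalar (-Complex.I) h := by
      change e h - (2 * Complex.I) • r (e h) = _
      rw [hre, he, LinearPMap.addScalar_apply]
      module
    rw [h1, ← sq_eq_sq₀ (norm_nonneg _) (norm_nonneg _), hD.norm_addScalar_neg_I_sq]
    exact (hD.norm_addScalar_I_sq h).symm
  have hcomm : (x : Module.End ℂ H) * u = u * x + c := by
    ext w
    change x (w - (2 * Complex.I) • r w) =
      x w - (2 * Complex.I) • r (x w) + (-2 : ℂ) • r (r (y w))
    rw [map_sub, map_smul, hxr, smul_sub, smul_smul, mul_assoc, Complex.I_mul_I]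
    module
  have hyr' : Commute (y : Module.End ℂ H) r := LinearMap.ext hyr
  have hcr : Commute c r :=
    (((Commute.refl r).mul_left (Commute.refl r)).mul_left hyr').smul_left _
  have hcu : Commute c u := (Commute.one_right c).sub_right (hcr.smul_right _)
  have hc0 := eq_zero_of_commutator_commute_isometry x u c hu hcomm hcu
  have hrinj : Function.Injective r := Subtype.val_injective.comp e.symm.injective
  ext w
  have hw : (-2 : ℂ) • r (r (y w)) = 0 := LinearMap.congr_fun hc0 w
  have hw' : r (r (y w)) = 0 := (smul_eq_zero.1 hw).resolve_left (by norm_num)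
  rw [map_eq_zero_iff r hrinj, map_eq_zero_iff r hrinj] at hw'
  exact hw'
end

section
/- Let H be a nontrivial complex Hilbert space (H contains a nonzero vector) and let D be a densely defined self-adjoint operator on H. Then there is no bounded operator x on H such that for every h ∈ dom D, x h ∈ dom D and D(x h) − x(D h) = i·h. That is, no bounded operator can satisfy the Heisenberg Commutation Relation with a self-adjoint operator D on the domain of D. -/
open scoped InnerProductSpace

theorem IsStarNormal.norm_pow_two_pow {A : Type*} [NormedRing A] [StarRing A] [CStarRing A]
    {a : A} (ha : IsStarNormal a) (k : ℕ) : ‖a ^ 2 ^ k‖ = ‖a‖ ^ 2 ^ k := by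
  have hpow : star (a ^ 2 ^ k) * a ^ 2 ^ k = (star a * a) ^ 2 ^ k := by
    rw [star_pow, ha.star_comm_self.mul_pow]
  have hnorm := (IsSelfAdjoint.star_mul_self a).norm_pow_two_pow k
  rw [← hpow, CStarRing.norm_star_mul_self, CStarRing.norm_star_mul_self, mul_pow] at hnorm
  exact (mul_self_inj (norm_nonneg _) (by positivity)).1 hnorm

theorem mul_pow_sub_pow_mul_of_commutator {A : Type*} [Ring A] [Algebra ℂ A] {x a : A} {c : ℂ}
    (h : x * a - a * x = c • (a * a)) (n : ℕ) :
    x * a ^ n - a ^ n * x = (n * c) • a ^ (n + 1) := by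
  induction n with
  | zero => simp
  | succ n ih =>
    calc x * a ^ (n + 1) - a ^ (n + 1) * x
        = (x * a ^ n - a ^ n * x) * a + a ^ n * (x * a - a * x) := by
          rw [pow_succ]; noncomm_ring
      _ = ((n + 1 : ℕ) * c) • a ^ (n + 1 + 1) := by
          rw [ih, h, smul_mul_assoc, mul_smul_comm, ← pow_succ, ← mul_assoc, ← pow_succ,
            ← pow_succ, ← add_smul]
          push_cast
          ring_nf

/-- A normal element `a` with `[x, a] = c • a²` and `c ≠ 0` vanishes. -/
theorem IsStarNormal.eq_zero_of_commutator {A : Type*} [NormedRing A] [StarRing A] [CStarRing A]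
    [NormedAlgebra ℂ A] {x a : A} (ha : IsStarNormal a) {c : ℂ} (hc : c ≠ 0)
    (h : x * a - a * x = c • (a * a)) : a = 0 := by
  by_contra hne
  have hpos : 0 < ‖a‖ := norm_pos_iff.2 hne
  have hcpos : 0 < ‖c‖ := norm_pos_iff.2 hc
  obtain ⟨n, hn⟩ := exists_nat_gt (2 * ‖x‖ / (‖c‖ * ‖a‖))
  rw [div_lt_iff₀ (by positivity)] at hn
  have hlt : n + 1 < 2 ^ (n + 1) := Nat.lt_two_pow_self
  obtain ⟨m, hm⟩ : ∃ m, 2 ^ (n + 1) = m + 1 := ⟨2 ^ (n + 1) - 1, by omega⟩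
  have hnm : n < m := by omega
  have hnorm : ‖a ^ (m + 1)‖ = ‖a‖ ^ (m + 1) := hm ▸ ha.norm_pow_two_pow (n + 1)
  have hle : m * ‖c‖ * ‖a‖ ^ (m + 1) ≤ 2 * ‖x‖ * ‖a‖ ^ m := by
    calc m * ‖c‖ * ‖a‖ ^ (m + 1) = ‖x * a ^ m - a ^ m * x‖ := by
          rw [mul_pow_sub_pow_mul_of_commutator h, norm_smul, hnorm, norm_mul,
            Complex.norm_natCast]
      _ ≤ ‖x‖ * ‖a ^ m‖ + ‖a ^ m‖ * ‖x‖ :=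
          norm_sub_le_of_le (norm_mul_le _ _) (norm_mul_le _ _)
      _ = 2 * ‖x‖ * ‖a ^ m‖ := by ring
      _ ≤ 2 * ‖x‖ * ‖a‖ ^ m := by
          gcongr
          exact norm_pow_le' a (by omega)
  have hle' : m * (‖c‖ * ‖a‖) ≤ 2 * ‖x‖ :=
    le_of_mul_le_mul_right (by rw [pow_succ] at hle; linarith) (pow_pos hpos m)
  have : (n : ℝ) * (‖c‖ * ‖a‖) ≤ m * (‖c‖ * ‖a‖) := by gcongr
  linarith

namespace LinearPMap

variable {H : Type*} [NormedAddCommGroup H] [InnerProductSpace ℂ H]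

theorem IsFormalAdjoint.abs_im_mul_norm_le {D : H →ₗ.[ℂ] H} (hD : D.IsFormalAdjoint D) (z : ℂ)
    (h : D.domain) : |z.im| * ‖(h : H)‖ ≤ ‖D h + z • (h : H)‖ := by
  have him : (⟪(h : H), D h⟫_ℂ).im = 0 := by
    have := inner_conj_symm (𝕜 := ℂ) (h : H) (D h)
    rw [hD h h] at this
    exact Complex.conj_eq_iff_im.1 this
  have hself : ⟪(h : H), (h : H)⟫_ℂ = ((‖(h : H)‖ ^ 2 : ℝ) : ℂ) := by
    rw [inner_self_eq_norm_sq_to_K, Complex.ofReal_pow]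
    rfl
  have hinner : (⟪(h : H), D h + z • (h : H)⟫_ℂ).im = z.im * ‖(h : H)‖ ^ 2 := by
    rw [inner_add_right, inner_smul_right, Complex.add_im, him, hself, Complex.im_mul_ofReal,
      zero_add]
  have hle : |z.im| * ‖(h : H)‖ ^ 2 ≤ ‖(h : H)‖ * ‖D h + z • (h : H)‖ := by
    calc |z.im| * ‖(h : H)‖ ^ 2 = |(⟪(h : H), D h + z • (h : H)⟫_ℂ).im| := by
          rw [hinner, abs_mul, abs_of_nonneg (sq_nonneg ‖(h : H)‖)]
      _ ≤ ‖⟪(h : H), D h + z • (h : H)⟫_ℂ‖ := Complex.abs_im_le_norm _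
      _ ≤ _ := norm_inner_le_norm _ _
  rcases (norm_nonneg (h : H)).eq_or_lt with h0 | h0
  · rw [← h0, mul_zero]; exact norm_nonneg _
  · exact le_of_mul_le_mul_left (by linarith) h0

variable [CompleteSpace H]

theorem isFormalAdjoint_of_adjoint_eq {D : H →ₗ.[ℂ] H} (hdense : Dense (D.domain : Set H))
    (hsa : D.adjoint = D) : D.IsFormalAdjoint D := by
  have := adjoint_isFormalAdjoint hdense
  rwa [hsa] at this

theorem isClosed_range_add_smul {D : H →ₗ.[ℂ] H} (hD : D.IsFormalAdjoint D)
    (hcl : D.IsClosed) {z : ℂ} (hz : z.im ≠ 0) :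
    _root_.IsClosed (LinearMap.range (D.toFun + z • D.domain.subtype) : Set H) := by
  have hz' : 0 < |z.im| := abs_pos.2 hz
  have : CompleteSpace D.graph := hcl.completeSpace_coe
  let f : D.graph →L[ℂ] H :=
    (ContinuousLinearMap.snd ℂ H H + z • ContinuousLinearMap.fst ℂ H H).comp D.graph.subtypeL
  have hf : ∀ (h : D.domain) (p : D.graph), (p : H × H) = ((h : H), D h) →
      f p = D h + z • (h : H) := by
    intro h p hp
    simp [f, hp]
  have hanti : AntilipschitzWith (1 + (1 + ‖z‖) / |z.im|).toNNReal f := by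
    refine f.antilipschitz_of_bound fun p => ?_
    obtain ⟨h, h1, h2⟩ := D.mem_graph_iff.1 p.2
    have hp : (p : H × H) = ((h : H), D h) := Prod.ext h1.symm h2.symm
    have hb := hD.abs_im_mul_norm_le z h
    rw [hf h p hp, Real.coe_toNNReal _ (by positivity)]
    set t := ‖D h + z • (h : H)‖
    have hb1 : ‖(h : H)‖ ≤ t / |z.im| := by rw [le_div_iff₀ hz']; linarith
    have hb2 : ‖D h‖ ≤ t + ‖z‖ * ‖(h : H)‖ := by
      rw [← norm_smul]
      exact norm_le_add_norm_add _ _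
    have hb3 : ‖z‖ * ‖(h : H)‖ ≤ ‖z‖ * (t / |z.im|) := by gcongr
    have ht : 0 ≤ t := norm_nonneg _
    have ht' : 0 ≤ t / |z.im| := by positivity
    have hzt : 0 ≤ ‖z‖ * (t / |z.im|) := by positivity
    have hexp : (1 + (1 + ‖z‖) / |z.im|) * t = t + t / |z.im| + ‖z‖ * (t / |z.im|) := by
      field_simp
      ring
    rw [hexp, Submodule.coe_norm, hp, Prod.norm_def]
    exact max_le (by simp only; linarith) (by simp only; linarith)
  convert hanti.isClosed_range f.uniformContinuous using 1
  ext u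
  constructor
  · rintro ⟨h, rfl⟩
    exact ⟨⟨_, D.mem_graph h⟩, hf h _ rfl⟩
  · rintro ⟨p, rfl⟩
    obtain ⟨h, h1, h2⟩ := D.mem_graph_iff.1 p.2
    exact ⟨h, (hf h p (Prod.ext h1.symm h2.symm)).symm⟩

theorem range_add_smul_eq_top {D : H →ₗ.[ℂ] H} (hdense : Dense (D.domain : Set H))
    (hsa : D.adjoint = D) {z : ℂ} (hz : z.im ≠ 0) :
    LinearMap.range (D.toFun + z • D.domain.subtype) = ⊤ := by
  have hD := isFormalAdjoint_of_adjoint_eq hdense hsa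
  have hcl : D.IsClosed := IsSelfAdjoint.isClosed (isSelfAdjoint_def.2 hsa)
  have : CompleteSpace (LinearMap.range (D.toFun + z • D.domain.subtype)) :=
    (isClosed_range_add_smul hD hcl hz).completeSpace_coe
  rw [← Submodule.orthogonal_eq_bot_iff, Submodule.eq_bot_iff]
  intro v hv
  have hv' : ∀ h : D.domain, ⟪-(starRingEnd ℂ z) • v, (h : H)⟫_ℂ = ⟪v, D h⟫_ℂ := by
    intro h
    have h0 : ⟪v, D h + z • (h : H)⟫_ℂ = 0 :=
      (Submodule.mem_orthogonal' _ v).1 hv _ ⟨h, rfl⟩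
    rw [inner_add_right, inner_smul_right] at h0
    rw [inner_smul_left, _root_.map_neg, Complex.conj_conj]
    linear_combination -h0
  have hmem : v ∈ D.adjoint.domain := mem_adjoint_domain_of_exists v ⟨_, hv'⟩
  have happ : D.adjoint ⟨v, hmem⟩ = -(starRingEnd ℂ z) • v := adjoint_apply_eq hdense _ hv'
  obtain ⟨hmem', happ'⟩ : ∃ hm : v ∈ D.domain, D ⟨v, hm⟩ = -(starRingEnd ℂ z) • v := by
    rw [← hsa]
    exact ⟨hmem, happ⟩
  have hb := hD.abs_im_mul_norm_le (starRingEnd ℂ z) ⟨v, hmem'⟩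
  rw [happ', neg_smul, neg_add_cancel, norm_zero, Complex.conj_im, abs_neg] at hb
  have hz' : 0 < |z.im| := abs_pos.2 hz
  exact norm_le_zero_iff.1 (nonpos_of_mul_nonpos_right hb hz')

/-- A self-adjoint operator shifted by a non-real scalar has a bounded inverse. -/
theorem exists_bounded_inverse_add_smul {D : H →ₗ.[ℂ] H} (hdense : Dense (D.domain : Set H))
    (hsa : D.adjoint = D) {z : ℂ} (hz : z.im ≠ 0) :
    ∃ R : H →L[ℂ] H, (∀ u, ∃ hm : R u ∈ D.domain, D ⟨R u, hm⟩ + z • R u = u) ∧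
      ∀ h : D.domain, R (D h + z • (h : H)) = h := by
  have hD := isFormalAdjoint_of_adjoint_eq hdense hsa
  have hz' : 0 < |z.im| := abs_pos.2 hz
  let L : D.domain →ₗ[ℂ] H := D.toFun + z • D.domain.subtype
  have hinj : Function.Injective L := by
    rw [injective_iff_map_eq_zero]
    intro h hh
    have hb := hD.abs_im_mul_norm_le z h
    rw [show D h + z • (h : H) = 0 from hh, norm_zero] at hb
    exact Subtype.ext (norm_le_zero_iff.1 (nonpos_of_mul_nonpos_right hb hz'))
  let e : D.domain ≃ₗ[ℂ] H := LinearEquiv.ofBijective L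
    ⟨hinj, LinearMap.range_eq_top.1 (range_add_smul_eq_top hdense hsa hz)⟩
  have he : ∀ u, D (e.symm u) + z • (e.symm u : H) = u := e.apply_symm_apply
  refine ⟨(D.domain.subtype ∘ₗ e.symm.toLinearMap).mkContinuous |z.im|⁻¹ fun u => ?_,
    fun u => ⟨(e.symm u).2, he u⟩, fun h => congrArg Subtype.val (e.symm_apply_apply h)⟩
  have hb := hD.abs_im_mul_norm_le z (e.symm u)
  rw [he u] at hb
  rw [inv_mul_eq_div, le_div_iff₀ hz', mul_comm]
  exact hb

/-- A nonreal resolvent operator of a self-adjoint operator is normal. -/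
theorem isStarNormal_of_inverse_add_smul {D : H →ₗ.[ℂ] H} (hdense : Dense (D.domain : Set H))
    (hsa : D.adjoint = D) {z : ℂ} (hz : z.im ≠ 0) {R : H →L[ℂ] H}
    (hR : ∀ u, ∃ hm : R u ∈ D.domain, D ⟨R u, hm⟩ + z • R u = u)
    (hR' : ∀ h : D.domain, R (D h + z • (h : H)) = h) : IsStarNormal R := by
  have hD := isFormalAdjoint_of_adjoint_eq hdense hsa
  obtain ⟨S, hS, hS'⟩ := exists_bounded_inverse_add_smul hdense hsa
    (z := starRingEnd ℂ z) (by simpa using hz)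
  have hadj : S = star R := by
    rw [ContinuousLinearMap.star_eq_adjoint, ContinuousLinearMap.eq_adjoint_iff]
    intro u v
    obtain ⟨hu, hu'⟩ := hS u
    obtain ⟨hv, hv'⟩ := hR v
    have hsymm : ⟪D ⟨S u, hu⟩, R v⟫_ℂ = ⟪S u, D ⟨R v, hv⟩⟫_ℂ := hD ⟨S u, hu⟩ ⟨R v, hv⟩
    conv_lhs => rw [← hv']
    conv_rhs => rw [← hu']
    rw [inner_add_left, inner_add_right, inner_smul_left, inner_smul_right, Complex.conj_conj,
      hsymm]
  have hSR : ∀ u, S u - R u = (z - starRingEnd ℂ z) • S (R u) := by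
    intro u
    obtain ⟨hv, hv'⟩ := hR u
    have h1 := hS' ⟨R u, hv⟩
    have h2 : S u = S (D ⟨R u, hv⟩ + starRingEnd ℂ z • R u + (z - starRingEnd ℂ z) • R u) := by
      conv_lhs => rw [← hv']
      congr 1
      module
    rw [h2, _root_.map_add, h1, _root_.map_smul, add_sub_cancel_left]
  have hRS : ∀ u, S u - R u = (z - starRingEnd ℂ z) • R (S u) := by
    intro u
    obtain ⟨hv, hv'⟩ := hS u
    have h1 := hR' ⟨S u, hv⟩
    have h2 : R u = R (D ⟨S u, hv⟩ + z • S u - (z - starRingEnd ℂ z) • S u) := by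
      conv_lhs => rw [← hv']
      congr 1
      module
    rw [h2, _root_.map_sub, h1, _root_.map_smul, sub_sub_cancel]
  have hne : z - starRingEnd ℂ z ≠ 0 := fun h0 =>
    hz (Complex.conj_eq_iff_im.1 (sub_eq_zero.1 h0).symm)
  rw [isStarNormal_iff, ← hadj]
  ext u
  exact smul_right_injective H hne ((hSR u).symm.trans (hRS u))

end LinearPMap


/-- **No bounded operator satisfies the Heisenberg Commutation Relation with a self-adjoint
operator on its whole domain.** Let `H` be a nontrivial complex Hilbert space and `D` a densely
defined self-adjoint operator on `H`.  Then there is no bounded operator `x` on `H` with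
`x (dom D) ⊆ dom D` and `D (x h) - x (D h) = i • h` for all `h ∈ dom D`. -/
theorem no_bounded_heisenberg_pair {H : Type*} [NormedAddCommGroup H]
    [InnerProductSpace ℂ H] [CompleteSpace H] [Nontrivial H] (D : H →ₗ.[ℂ] H)
    (hdense : Dense (D.domain : Set H)) (hsa : D.adjoint = D) :
    ¬ ∃ x : H →L[ℂ] H, ∀ h : D.domain,
        ∃ hm : x h ∈ D.domain, D ⟨x h, hm⟩ - x (D h) = Complex.I • (h : H) := by
  rintro ⟨x, hx⟩
  have hI : Complex.I.im ≠ 0 := by simp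
  obtain ⟨R, hR, hR'⟩ := LinearPMap.exists_bounded_inverse_add_smul hdense hsa hI
  have hcomm : x * R - R * x = Complex.I • (R * R) := by
    ext u
    obtain ⟨hm, hu⟩ := hR u
    obtain ⟨hxm, hxu⟩ := hx ⟨R u, hm⟩
    have h1 : x (R u) = R (D ⟨x (R u), hxm⟩ + Complex.I • x (R u)) := (hR' ⟨_, hxm⟩).symm
    have h2 : D ⟨x (R u), hxm⟩ + Complex.I • x (R u) = x u + Complex.I • R u := by
      rw [sub_eq_iff_eq_add.1 hxu, ← map_smul x, add_assoc, ← map_add x, hu, add_comm]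
    change x (R u) - R (x u) = Complex.I • R (R u)
    rw [h1, h2, map_add, map_smul, add_sub_cancel_left]
  have hR0 : R = 0 := (LinearPMap.isStarNormal_of_inverse_add_smul hdense hsa hI hR
    hR').eq_zero_of_commutator Complex.I_ne_zero hcomm
  obtain ⟨v, hv⟩ := exists_ne (0 : H)
  obtain ⟨hm, hu⟩ := hR v
  have hzero : (⟨R v, hm⟩ : D.domain) = 0 := Subtype.ext (by simp [hR0])
  rw [hzero, LinearPMap.map_zero, hR0] at hu
  simp at hu
  exact hv hu.symm
end

section
/- Let H be a nontrivial complex Hilbert space and let A and B be densely defined self-adjoint operators on H. Let K be a dense submodule of H such that every k ∈ K lies in dom A ∩ dom B with A k ∈ dom B and B k ∈ dom A, and such that A(B k) − B(A k) = i·k for all k ∈ K (A and B satisfy the Heisenberg Commutation Relation on K). If K is a core for A and a core for B (the closure of the restriction of A to K equals A, and likewise for B), then both A and B are unbounded: there is no constant C with ‖A h‖ ≤ C·‖h‖ for all h ∈ dom A, and there is no constant C with ‖B h‖ ≤ C·‖h‖ for all h ∈ dom B. -/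
open scoped InnerProductSpace

/-- In a C⋆-algebra, the norm of a power of a normal element dominates the power of its norm. -/
theorem IsStarNormal.norm_pow_succ_le {A : Type*} [CStarAlgebra A] [Nontrivial A]
    (r : A) [IsStarNormal r] (n : ℕ) : ‖r‖ ^ (n + 1) ≤ ‖r ^ (n + 1)‖ := by
  have h := spectrum.spectralRadius_le_pow_nnnorm_pow_one_div ℂ r n
  rw [IsStarNormal.spectralRadius_eq_nnnorm r, nnnorm_one, ENNReal.coe_one, ENNReal.one_rpow,
    mul_one, one_div, ENNReal.le_rpow_inv_iff (by positivity)] at h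
  have h' : (‖r‖₊ : ENNReal) ^ (n + 1) ≤ ‖r ^ (n + 1)‖₊ := by
    rw [← ENNReal.rpow_natCast]
    exact_mod_cast h
  exact_mod_cast h'

theorem mul_pow_eq_pow_mul_add_of_mul_eq {R : Type*} [Ring R] [Algebra ℂ R] {a r : R} {c : ℂ}
    (h : a * r = r * a + c • (r * r)) (n : ℕ) :
    a * r ^ n = r ^ n * a + (n * c) • r ^ (n + 1) := by
  induction n with
  | zero => simp
  | succ n ih =>
    rw [pow_succ, ← mul_assoc, ih, add_mul, mul_assoc, h, mul_add, ← mul_assoc, mul_smul_comm,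
      smul_mul_assoc, add_assoc, ← pow_succ (r) (n + 1), pow_succ r (n + 1), pow_succ r n,
      ← mul_assoc, ← add_smul]
    congr 2
    push_cast
    ring

/-- A version of the Kleinecke-Shirokov theorem for normal elements: if the commutator of `a` with
a normal element `r` is a nonzero multiple of `r ^ 2`, then `r` vanishes. -/
theorem IsStarNormal.eq_zero_of_mul_eq_mul_add_smul_sq {A : Type*} [CStarAlgebra A]
    {a r : A} [IsStarNormal r] {c : ℂ} (hc : c ≠ 0) (h : a * r = r * a + c • (r * r)) :
    r = 0 := by
  nontriviality A
  by_contra hr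
  have hr' : 0 < ‖r‖ := norm_pos_iff.mpr hr
  have key (n : ℕ) : ((n + 1 : ℕ) : ℝ) * (‖c‖ * ‖r‖) ≤ 2 * ‖a‖ := by
    have h₁ : (((n + 1 : ℕ) : ℂ) * c) • r ^ (n + 2) = a * r ^ (n + 1) - r ^ (n + 1) * a :=
      eq_sub_of_add_eq' (mul_pow_eq_pow_mul_add_of_mul_eq h (n + 1)).symm
    have h₂ : ‖(((n + 1 : ℕ) : ℂ) * c) • r ^ (n + 2)‖ ≤ 2 * ‖a‖ * ‖r‖ ^ (n + 1) := by
      have h₃ := norm_pow_le r (n + 1)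
      calc _ ≤ ‖a‖ * ‖r ^ (n + 1)‖ + ‖r ^ (n + 1)‖ * ‖a‖ := by
            rw [h₁]
            exact (norm_sub_le _ _).trans (add_le_add (norm_mul_le _ _) (norm_mul_le _ _))
        _ = 2 * ‖a‖ * ‖r ^ (n + 1)‖ := by ring
        _ ≤ _ := by gcongr
    rw [norm_smul, norm_mul, Complex.norm_natCast] at h₂
    refine le_of_mul_le_mul_right ?_ (pow_pos hr' (n + 1))
    calc _ = ((n + 1 : ℕ) : ℝ) * ‖c‖ * ‖r‖ ^ (n + 1 + 1) := by ring
      _ ≤ ((n + 1 : ℕ) : ℝ) * ‖c‖ * ‖r ^ (n + 2)‖ := by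
        gcongr
        exact IsStarNormal.norm_pow_succ_le r (n + 1)
      _ ≤ _ := h₂
  have hpos : 0 < ‖c‖ * ‖r‖ := mul_pos (norm_pos_iff.mpr hc) hr'
  obtain ⟨n, hn⟩ := exists_nat_gt (2 * ‖a‖ / (‖c‖ * ‖r‖))
  rw [div_lt_iff₀ hpos] at hn
  have := key n
  push_cast at this
  linarith

namespace Submodule

variable {H : Type*} [NormedAddCommGroup H] [InnerProductSpace ℂ H] {G : Submodule ℂ (H × H)}

theorem inner_snd_fst_eq_of_adjoint_eq_self (hG : G.adjoint = G) {p q : H × H}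
    (hp : p ∈ G) (hq : q ∈ G) : ⟪p.2, q.1⟫_ℂ = ⟪p.1, q.2⟫_ℂ := by
  rw [← hG, mem_adjoint_iff] at hq
  exact sub_eq_zero.mp (hq p.1 p.2 hp)

theorem norm_sub_smul_sq_of_adjoint_eq_self (hG : G.adjoint = G) {z : ℂ}
    (hz : z = Complex.I ∨ z = -Complex.I) {p : H × H} (hp : p ∈ G) :
    ‖p.2 - z • p.1‖ ^ 2 = ‖p.2‖ ^ 2 + ‖p.1‖ ^ 2 := by
  have h := inner_snd_fst_eq_of_adjoint_eq_self hG hp hp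
  have him : (⟪p.2, p.1⟫_ℂ).im = 0 := by
    have h' := congrArg Complex.im h
    rw [← inner_conj_symm p.1 p.2, Complex.conj_im] at h'
    linarith
  have hre : (z * ⟪p.2, p.1⟫_ℂ).re = 0 := by
    rcases hz with rfl | rfl <;> simp [him]
  have hnz : ‖z‖ = 1 := by rcases hz with rfl | rfl <;> simp
  rw [@norm_sub_sq ℂ, inner_smul_right, norm_smul, hnz, RCLike.re_eq_complex_re, hre, mul_zero,
    sub_zero, one_mul]

variable [CompleteSpace H]

theorem exists_mem_of_adjoint_eq_self (hG : G.adjoint = G) (hGc : IsClosed (G : Set (H × H)))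
    {z : ℂ} (hz : z = Complex.I ∨ z = -Complex.I) (x : H) : ∃ u, (u, x + z • u) ∈ G := by
  let L : G →L[ℂ] H :=
    (ContinuousLinearMap.snd ℂ H H - z • ContinuousLinearMap.fst ℂ H H).comp G.subtypeL
  have hL (p : G) : L p = (p : H × H).2 - z • (p : H × H).1 := rfl
  have hbound (p : G) : ‖p‖ ≤ ‖L p‖ := by
    have h := norm_sub_smul_sq_of_adjoint_eq_self hG hz p.2
    rw [← hL] at h
    change max ‖(p : H × H).1‖ ‖(p : H × H).2‖ ≤ _
    refine max_le ?_ ?_ <;> refine le_of_sq_le_sq ?_ (norm_nonneg _) <;>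
      nlinarith [sq_nonneg ‖(p : H × H).1‖, sq_nonneg ‖(p : H × H).2‖]
  have : CompleteSpace G := hGc.completeSpace_coe
  have hanti : AntilipschitzWith 1 L :=
    L.antilipschitz_of_bound fun p => by simpa using hbound p
  have hclosed : IsClosed (L.range : Set H) := by
    rw [LinearMap.coe_range]
    exact hanti.isClosed_range L.uniformContinuous
  have : CompleteSpace L.range := hclosed.completeSpace_coe
  have htop : L.range = ⊤ := by
    rw [← orthogonal_eq_bot_iff, eq_bot_iff]
    intro y hy
    have hyG : (y, (starRingEnd ℂ) z • y) ∈ G := by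
      rw [← hG, mem_adjoint_iff]
      intro u v huv
      have h := hy _ (LinearMap.mem_range_self _ (⟨(u, v), huv⟩ : G))
      have h' : ⟪v - z • u, y⟫_ℂ = 0 := h
      rwa [inner_sub_left, inner_smul_left, ← inner_smul_right] at h'
    have hz' : (starRingEnd ℂ) z = Complex.I ∨ (starRingEnd ℂ) z = -Complex.I := by
      rcases hz with rfl | rfl <;> simp
    have h := norm_sub_smul_sq_of_adjoint_eq_self hG hz' hyG
    simp only [sub_self, norm_zero] at h
    rw [mem_bot, ← norm_eq_zero]
    nlinarith [sq_nonneg ‖y‖, sq_nonneg ‖(starRingEnd ℂ) z • y‖]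
  obtain ⟨p, hp⟩ : x ∈ L.range := htop ▸ mem_top
  refine ⟨(p : H × H).1, ?_⟩
  have hp' : x + z • (p : H × H).1 = (p : H × H).2 := by
    rw [← hp]
    change (p : H × H).2 - z • (p : H × H).1 + _ = _
    abel
  rw [hp']
  exact p.2

/-- The resolvent at `±i` of a self-adjoint linear relation. -/
theorem exists_resolvent_of_adjoint_eq_self (hG : G.adjoint = G)
    (hGc : IsClosed (G : Set (H × H))) {z : ℂ} (hz : z = Complex.I ∨ z = -Complex.I) :
    ∃ R : H →L[ℂ] H, (∀ x, (R x, x + z • R x) ∈ G) ∧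
      ∀ u v, (u, v) ∈ G → R (v - z • u) = u := by
  choose f hf using exists_mem_of_adjoint_eq_self hG hGc hz
  have huniq {u v : H} (huv : (u, v) ∈ G) : f (v - z • u) = u := by
    have hmem := G.sub_mem (hf (v - z • u)) huv
    have h := norm_sub_smul_sq_of_adjoint_eq_self hG hz hmem
    have h0 : v - z • u + z • f (v - z • u) - v - z • (f (v - z • u) - u) = 0 := by
      rw [smul_sub]
      abel
    simp only [Prod.mk_sub_mk, h0, norm_zero] at h
    rw [← sub_eq_zero, ← norm_eq_zero]
    nlinarith [sq_nonneg ‖f (v - z • u) - u‖,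
      sq_nonneg ‖v - z • u + z • f (v - z • u) - v‖]
  let F : H →ₗ[ℂ] H :=
    { toFun := f
      map_add' := fun x y => by
        have h := huniq (G.add_mem (hf x) (hf y))
        rwa [show x + z • f x + (y + z • f y) - z • (f x + f y) = x + y by
          rw [smul_add]; abel] at h
      map_smul' := fun a x => by
        have h := huniq (G.smul_mem a (hf x))
        rwa [show a • (x + z • f x) - z • a • f x = a • x by
          rw [smul_add, smul_comm z a]; abel] at h }
  have hF (x : H) : ‖F x‖ ≤ 1 * ‖x‖ := by
    have h := norm_sub_smul_sq_of_adjoint_eq_self hG hz (hf x)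
    simp only [add_sub_cancel_right] at h
    rw [one_mul]
    refine le_of_sq_le_sq ?_ (norm_nonneg _)
    change ‖f x‖ ^ 2 ≤ _
    nlinarith [sq_nonneg ‖x + z • f x‖]
  exact ⟨F.mkContinuous 1 hF, hf, fun u v huv => huniq huv⟩

/-- The resolvent at `i` of a self-adjoint linear relation is normal. -/
theorem exists_normal_resolvent_of_adjoint_eq_self (hG : G.adjoint = G)
    (hGc : IsClosed (G : Set (H × H))) :
    ∃ R : H →L[ℂ] H, IsStarNormal R ∧ (∀ x, (R x, x + Complex.I • R x) ∈ G) ∧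
      ∀ u v, (u, v) ∈ G → R (v - Complex.I • u) = u := by
  obtain ⟨R, hR, hR'⟩ := exists_resolvent_of_adjoint_eq_self hG hGc (Or.inl rfl)
  obtain ⟨S, hS, hS'⟩ := exists_resolvent_of_adjoint_eq_self hG hGc (Or.inr rfl)
  have hadj : star R = S := by
    rw [ContinuousLinearMap.star_eq_adjoint]
    refine ((ContinuousLinearMap.eq_adjoint_iff _ _).mpr fun x y => ?_).symm
    have h := inner_snd_fst_eq_of_adjoint_eq_self hG (hS x) (hR y)
    simp only [inner_add_left, inner_add_right, inner_smul_left, inner_smul_right, map_neg,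
      Complex.conj_I, neg_neg] at h
    exact (add_right_cancel h).symm
  have hcomm : S * R = R * S := by
    ext x
    have h₁ := hR' _ _ (G.sub_mem (hS x) (hR x))
    have h₂ := hS' _ _ (G.sub_mem (hS x) (hR x))
    have e₁ : x + -Complex.I • S x - (x + Complex.I • R x) - Complex.I • (S x - R x)
        = (-2 * Complex.I) • S x := by module
    have e₂ : x + -Complex.I • S x - (x + Complex.I • R x) - -Complex.I • (S x - R x)
        = (-2 * Complex.I) • R x := by module
    rw [e₁, map_smul] at h₁
    rw [e₂, map_smul] at h₂
    exact smul_right_injective H (show -2 * Complex.I ≠ 0 by simp) (h₂.trans h₁.symm)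
  refine ⟨R, ⟨?_⟩, hR, hR'⟩
  rw [hadj]
  exact hcomm

/-- A bounded operator cannot satisfy the Heisenberg relation with a self-adjoint relation whose
domain it preserves, unless that relation has trivial domain. -/
theorem fst_eq_zero_of_adjoint_eq_self (hG : G.adjoint = G) (hGc : IsClosed (G : Set (H × H)))
    (a : H →L[ℂ] H) {c : ℂ} (hc : c ≠ 0)
    (ha : ∀ u v, (u, v) ∈ G → (a u, a v + c • u) ∈ G) {u v : H} (huv : (u, v) ∈ G) : u = 0 := by
  obtain ⟨R, hRn, hR, hR'⟩ := exists_normal_resolvent_of_adjoint_eq_self hG hGc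
  have hcomm : a * R = R * a + c • (R * R) := by
    ext x
    have h := hR' _ _ (ha _ _ (hR x))
    rw [show a (x + Complex.I • R x) + c • R x - Complex.I • a (R x) = a x + c • R x by
      rw [map_add, map_smul]; abel, map_add, map_smul] at h
    exact h.symm
  have hR0 : R = 0 := IsStarNormal.eq_zero_of_mul_eq_mul_add_smul_sq hc hcomm
  rw [← hR' u v huv, hR0, zero_apply]

end Submodule

namespace LinearPMap

variable {H : Type*} [NormedAddCommGroup H] [InnerProductSpace ℂ H] [CompleteSpace H]

/-- A bounded self-adjoint operator is everywhere defined. -/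
theorem exists_continuousLinearMap_of_adjoint_eq_self {A : H →ₗ.[ℂ] H} (hA : A.adjoint = A)
    {C : ℝ} (hC : ∀ h : A.domain, ‖A h‖ ≤ C * ‖(h : H)‖) :
    ∃ a : H →L[ℂ] H, ∀ x, (x, a x) ∈ A.graph := by
  have htop (x : H) : x ∈ A.domain := by
    rw [← hA, mem_adjoint_domain_iff]
    exact (innerSL ℂ x).continuous.comp (A.toFun.mkContinuous C hC).continuous
  let F : H →ₗ[ℂ] H := A.toFun.comp (LinearMap.id.codRestrict A.domain htop)
  exact ⟨F.mkContinuous C fun x => hC ⟨x, htop x⟩, fun x => A.mem_graph ⟨x, htop x⟩⟩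

/-- If `A` and `B` satisfy a nonzero canonical commutation relation on a core for `B`, then `A` is
unbounded. -/
theorem not_bounded_of_commutator_eq_smul_on_core [Nontrivial H] {A B : H →ₗ.[ℂ] H}
    (hA : A.adjoint = A) (hBdense : Dense (B.domain : Set H)) (hB : B.adjoint = B)
    (K : Submodule ℂ H) (hKA : K ≤ A.domain) (hKB : K ≤ B.domain)
    (hABmem : ∀ k : K, B ⟨(k : H), hKB k.2⟩ ∈ A.domain)
    (hBAmem : ∀ k : K, A ⟨(k : H), hKA k.2⟩ ∈ B.domain) {c : ℂ} (hc : c ≠ 0)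
    (hcomm : ∀ k : K,
      A ⟨B ⟨(k : H), hKB k.2⟩, hABmem k⟩ - B ⟨A ⟨(k : H), hKA k.2⟩, hBAmem k⟩ = c • (k : H))
    (hcore : (B.domRestrict K).closure = B) :
    ¬ ∃ C : ℝ, ∀ h : A.domain, ‖A h‖ ≤ C * ‖(h : H)‖ := by
  rintro ⟨C, hC⟩
  obtain ⟨a, ha⟩ := exists_continuousLinearMap_of_adjoint_eq_self hA hC
  have ha' (x : A.domain) : A x = a x := mem_graph_snd_inj A (A.mem_graph x) (ha x) rfl
  have hBc : B.IsClosed := IsSelfAdjoint.isClosed hB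
  have hG : B.graph.adjoint = B.graph := by rw [← adjoint_graph_eq_graph_adjoint hBdense, hB]
  have hgraph : (B.domRestrict K).graph.topologicalClosure = B.graph := by
    rw [(hBc.isClosable.leIsClosable domRestrict_le).graph_closure_eq_closure_graph, hcore]
  let Φ : H × H → H × H := fun p => (a p.1, a p.2 + (-c) • p.1)
  have hΦ : Continuous Φ := by fun_prop
  have hmaps : Set.MapsTo Φ (B.domRestrict K).graph B.graph := by
    rintro p hp
    obtain ⟨⟨k, hk⟩, rfl⟩ := (mem_graph_iff' _).mp hp
    have hkK : k ∈ K := hk.1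
    have hBk : B.domRestrict K ⟨k, hk⟩ = B ⟨k, hKB hkK⟩ := domRestrict_apply rfl
    have h := hcomm ⟨k, hkK⟩
    have hmem := B.mem_graph ⟨A ⟨k, hKA hkK⟩, hBAmem ⟨k, hkK⟩⟩
    rw [sub_eq_iff_eq_add, ha', ← sub_eq_iff_eq_add'] at h
    change (a k, a (B.domRestrict K ⟨k, hk⟩) + (-c) • k) ∈ B.graph
    rwa [hBk, neg_smul, ← sub_eq_add_neg, h, ← ha' ⟨k, hKA hkK⟩]
  have hinv : ∀ u v, (u, v) ∈ B.graph → (a u, a v + (-c) • u) ∈ B.graph := by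
    intro u v huv
    rw [← hgraph] at huv
    have h := hmaps.closure hΦ huv
    rwa [hBc.closure_eq] at h
  have hbot : B.domain = ⊥ := by
    rw [eq_bot_iff]
    intro x hx
    exact Submodule.fst_eq_zero_of_adjoint_eq_self hG hBc a (neg_ne_zero.mpr hc) hinv
      (B.mem_graph ⟨x, hx⟩)
  obtain ⟨x, hx⟩ := exists_ne (0 : H)
  refine hx ?_
  have := hBdense x
  rwa [hbot, Submodule.bot_coe, closure_singleton, Set.mem_singleton_iff] at this

end LinearPMap


/-- **Application 2 of the paper.** Let `H` be a nontrivial complex Hilbert space and let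
`A`, `B` be densely defined self-adjoint operators satisfying the Heisenberg Commutation
Relation `[A, B] k = i • k` on a dense submodule `K ⊆ dom [A,B]`.  If `K` is a core for `A`
and a core for `B`, then both `A` and `B` are unbounded. -/
theorem heisenberg_pair_core_both_unbounded {H : Type*} [NormedAddCommGroup H]
    [InnerProductSpace ℂ H] [CompleteSpace H] [Nontrivial H]
    (A B : H →ₗ.[ℂ] H)
    (hAdense : Dense (A.domain : Set H)) (hAsa : A.adjoint = A)
    (hBdense : Dense (B.domain : Set H)) (hBsa : B.adjoint = B)
    (K : Submodule ℂ H) (hKdense : Dense (K : Set H))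
    (hKA : K ≤ A.domain) (hKB : K ≤ B.domain)
    (hABmem : ∀ k : K, B ⟨(k : H), hKB k.2⟩ ∈ A.domain)
    (hBAmem : ∀ k : K, A ⟨(k : H), hKA k.2⟩ ∈ B.domain)
    (hHCR : ∀ k : K,
      A ⟨B ⟨(k : H), hKB k.2⟩, hABmem k⟩ - B ⟨A ⟨(k : H), hKA k.2⟩, hBAmem k⟩
        = Complex.I • (k : H))
    (hcoreA : (A.domRestrict K).closure = A)
    (hcoreB : (B.domRestrict K).closure = B) :
    (¬ ∃ C : ℝ, ∀ h : A.domain, ‖A h‖ ≤ C * ‖(h : H)‖) ∧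
    (¬ ∃ C : ℝ, ∀ h : B.domain, ‖B h‖ ≤ C * ‖(h : H)‖) := by
  refine ⟨LinearPMap.not_bounded_of_commutator_eq_smul_on_core hAsa hBdense hBsa K hKA hKB hABmem
      hBAmem Complex.I_ne_zero hHCR hcoreB,
    LinearPMap.not_bounded_of_commutator_eq_smul_on_core hBsa hAdense hAsa K hKB hKA hBAmem
      hABmem (neg_ne_zero.mpr Complex.I_ne_zero) (fun k => ?_) hcoreA⟩
  rw [← neg_sub, hHCR, neg_smul]
end
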